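/- Let V be a finite-dimensional real normed vector space, θ : V → ℝ a nonzero linear functional, and τ an alternating bilinear form on V whose restriction to ker θ is nondegenerate. Let K₀ and C be complementary linear subspaces of V (K₀ ∩ C = 0 and K₀ + C = V). For a linear map L : K₀ → C let G_L := {x + L(x) : x ∈ K₀} be its graph subspace. Then the set of all linear maps L : K₀ → C such that (i) G_L is not contained in ker θ and (ii) the restriction of τ to G_L ∩ ker θ is nondegenerate (if v ∈ G_L ∩ ker θ and τ(v, w) = 0 for all w ∈ G_L ∩ ker θ, then v = 0), is an open subset of the space of linear maps from K₀ to C with the operator-norm topology. -/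

import Mathlib

/-- The symmetric bordering of a bilinear form `τ` by a functional `θ`:
`((x, s), (y, t)) ↦ τ x y + s * θ y + t * θ x`. -/
noncomputable def borderedForm {V : Type*} [NormedAddCommGroup V] [NormedSpace ℝ V]
    [FiniteDimensional ℝ V] (θ : V →ₗ[ℝ] ℝ) (τ : V →ₗ[ℝ] V →ₗ[ℝ] ℝ) :
    V × ℝ →L[ℝ] V × ℝ →L[ℝ] ℝ :=
  LinearMap.toContinuousLinearMap (LinearMap.toContinuousLinearMap.toLinearMap ∘ₗ
    LinearMap.mk₂ ℝ (fun p q : V × ℝ => τ p.1 q.1 + p.2 * θ q.1 + q.2 * θ p.1)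
      (by intros; simp; ring) (by intros; simp; ring)
      (by intros; simp; ring) (by intros; simp; ring))

theorem borderedForm_apply {V : Type*} [NormedAddCommGroup V] [NormedSpace ℝ V]
    [FiniteDimensional ℝ V] (θ : V →ₗ[ℝ] ℝ) (τ : V →ₗ[ℝ] V →ₗ[ℝ] ℝ) (p q : V × ℝ) :
    borderedForm θ τ p q = τ p.1 q.1 + p.2 * θ q.1 + q.2 * θ p.1 := rfl

/-- For an injective `g`, the pullback of the bordered form along `g × id` is injective exactly when
the range of `g` is not contained in `ker θ` and `τ` is nondegenerate on `range g ⊓ ker θ`. -/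
theorem injective_bilinearComp_borderedForm_iff {V W : Type*}
    [NormedAddCommGroup V] [NormedSpace ℝ V] [FiniteDimensional ℝ V]
    [NormedAddCommGroup W] [NormedSpace ℝ W]
    (θ : V →ₗ[ℝ] ℝ) (τ : V →ₗ[ℝ] V →ₗ[ℝ] ℝ) (g : W →L[ℝ] V) (hg : Function.Injective g) :
    Function.Injective ((borderedForm θ τ).bilinearComp
        (g.prodMap (ContinuousLinearMap.id ℝ ℝ)) (g.prodMap (ContinuousLinearMap.id ℝ ℝ))) ↔
      ¬ (LinearMap.range (g : W →ₗ[ℝ] V) ≤ LinearMap.ker θ) ∧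
      (∀ v ∈ LinearMap.range (g : W →ₗ[ℝ] V) ⊓ LinearMap.ker θ,
        (∀ w ∈ LinearMap.range (g : W →ₗ[ℝ] V) ⊓ LinearMap.ker θ, τ v w = 0) → v = 0) := by
  have key : ∀ p : W × ℝ, ((borderedForm θ τ).bilinearComp
      (g.prodMap (ContinuousLinearMap.id ℝ ℝ)) (g.prodMap (ContinuousLinearMap.id ℝ ℝ))) p = 0 ↔
      θ (g p.1) = 0 ∧ ∀ y, τ (g p.1) (g y) + p.2 * θ (g y) = 0 := by
    intro p
    constructor
    · intro h
      have h' : ∀ q : W × ℝ,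
          τ (g p.1) (g q.1) + p.2 * θ (g q.1) + q.2 * θ (g p.1) = 0 :=
        fun q => DFunLike.congr_fun h q
      exact ⟨by simpa using h' (0, 1), fun y => by simpa using h' (y, 0)⟩
    · rintro ⟨h₁, h₂⟩
      ext q <;> simp [borderedForm_apply, h₁, h₂]
  rw [injective_iff_map_eq_zero]
  simp only [key]
  constructor
  · intro h
    have hnot : ¬ (LinearMap.range (g : W →ₗ[ℝ] V) ≤ LinearMap.ker θ) := by
      intro hle
      have := h (0, 1) ⟨by simp, fun y => by simpa using hle ⟨y, rfl⟩⟩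
      simp at this
    refine ⟨hnot, ?_⟩
    obtain ⟨_, ⟨e, rfl⟩, he⟩ := SetLike.not_le_iff_exists.1 hnot
    replace he : θ (g e) ≠ 0 := he
    rintro _ ⟨⟨x, rfl⟩, hx⟩ hτ
    have h0 : (x, -(τ (g x) (g e) / θ (g e))) = 0 := by
      refine h _ ⟨hx, fun y => ?_⟩
      have := hτ (g (y - (θ (g y) / θ (g e)) • e)) ⟨⟨_, rfl⟩, by simp [he]⟩
      simp only [ContinuousLinearMap.coe_coe, map_sub, map_smul, smul_eq_mul] at this
      linear_combination this
    simp [(Prod.mk_eq_zero.1 h0).1]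
  · rintro ⟨hnot, hτ⟩ ⟨x, s⟩ ⟨hx, hs⟩
    have hgx : g x = 0 := by
      refine hτ _ ⟨⟨x, rfl⟩, hx⟩ ?_
      rintro _ ⟨⟨y, rfl⟩, hy⟩
      replace hy : θ (g y) = 0 := hy
      simpa [hy] using hs y
    obtain ⟨_, ⟨e, rfl⟩, he⟩ := SetLike.not_le_iff_exists.1 hnot
    replace he : θ (g e) ≠ 0 := he
    have hs0 : s = 0 := by simpa [hgx, he] using hs e
    rw [hs0, (map_eq_zero_iff g hg).1 hgx]
    rfl


/-- Chart-level openness of the set of almost contact subspaces.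
`V` is a finite-dimensional real normed space with a nonzero functional `θ` and an
alternating bilinear form `τ` nondegenerate on `ker θ`; `K₀` and `C` are complementary
subspaces.  For `L : K₀ →L[ℝ] C` let `G_L = {x + L x : x ∈ K₀}` be its graph.  The set of
`L` such that `G_L ⊄ ker θ` and `τ` is nondegenerate on `G_L ∩ ker θ` is open. -/
theorem almost_contact_subspaces_chart_isOpen
    (V : Type*) [NormedAddCommGroup V] [NormedSpace ℝ V] [FiniteDimensional ℝ V]
    (θ : V →ₗ[ℝ] ℝ) (hθ : θ ≠ 0)
    (τ : V →ₗ[ℝ] V →ₗ[ℝ] ℝ) (halt : ∀ v : V, τ v v = 0)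
    (hnd : ∀ v ∈ LinearMap.ker θ, (∀ w ∈ LinearMap.ker θ, τ v w = 0) → v = 0)
    (K₀ C : Submodule ℝ V) (hKC : K₀ ⊓ C = ⊥) (hKC' : K₀ ⊔ C = ⊤) :
    IsOpen {L : K₀ →L[ℝ] C |
      ¬ (LinearMap.range (K₀.subtype + C.subtype ∘ₗ (L : K₀ →ₗ[ℝ] C)) ≤ LinearMap.ker θ) ∧
      (∀ v ∈ LinearMap.range (K₀.subtype + C.subtype ∘ₗ (L : K₀ →ₗ[ℝ] C)) ⊓ LinearMap.ker θ,
        (∀ w ∈ LinearMap.range (K₀.subtype + C.subtype ∘ₗ (L : K₀ →ₗ[ℝ] C)) ⊓ LinearMap.ker θ,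
          τ v w = 0) → v = 0)} := by
  let g : (K₀ →L[ℝ] C) → (K₀ →L[ℝ] V) := fun L => K₀.subtypeL + C.subtypeL ∘L L
  have hg : ∀ L, Function.Injective (g L) := by
    intro L
    rw [injective_iff_map_eq_zero]
    intro x hx
    have hx' : (x : V) + (L x : V) = 0 := hx
    have hxC : (x : V) ∈ C := by
      rw [eq_neg_of_add_eq_zero_left hx']
      exact C.neg_mem (L x).2
    have : (x : V) ∈ K₀ ⊓ C := ⟨x.2, hxC⟩
    rw [hKC, Submodule.mem_bot] at this
    exact Subtype.ext this
  have hcont : Continuous fun L => (borderedForm θ τ).bilinearComp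
      ((g L).prodMap (ContinuousLinearMap.id ℝ ℝ))
      ((g L).prodMap (ContinuousLinearMap.id ℝ ℝ)) := by
    refine continuous_clm_apply.2 fun p => continuous_clm_apply.2 fun q => ?_
    change Continuous fun L : K₀ →L[ℝ] C =>
      borderedForm θ τ (↑p.1 + ↑(L p.1), p.2) (↑q.1 + ↑(L q.1), q.2)
    fun_prop
  convert ContinuousLinearMap.isOpen_injective.preimage hcont using 1
  ext L
  exact (injective_bilinearComp_borderedForm_iff θ τ (g L) (hg L)).symm
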